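/- Let σ² ≤ 4a, T > 0, and X_1(w,x) = (√x + wσ/2)². Let Y be a symmetric random variable with E[Y²] = 1 and all even moments finite. For any polynomial f(x) = Σ_{j=0}^L a_j x^j on ℝ₊ with norm ‖f‖ = Σ_j |a_j|, the function x ↦ E[f(X_1(√t Y, x))] is again a polynomial of degree ≤ L, and ‖E[f(X_1(√t Y, ·))]‖ ≤ (1 + E[Y^{2L}] C₁^L t) ‖f‖ for t ∈ [0,T], with C₁ = (1 + (σ/2)√(1∨T))². -/

import Mathlib

open MeasureTheory

lemma aux_even (f : ℕ → ℝ) (h : ∀ i, f (2 * i + 1) = 0) (j : ℕ) :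
    ∑ m ∈ Finset.range (2 * j + 1), f m = ∑ i ∈ Finset.range (j + 1), f (2 * i) := by
  induction j with
  | zero => simp
  | succ k ih =>
    rw [show 2 * (k + 1) + 1 = (2 * k + 1) + 1 + 1 by ring, Finset.sum_range_succ,
      Finset.sum_range_succ, ih, h, Finset.sum_range_succ _ (k + 1)]
    simp [mul_add]

lemma aux_le (f : ℕ → ℝ) (h : ∀ i, 0 ≤ f i) (j : ℕ) :
    ∑ i ∈ Finset.range (j + 1), f (2 * i) ≤ ∑ m ∈ Finset.range (2 * j + 1), f m := by
  induction j with
  | zero => simp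
  | succ k ih =>
    rw [show 2 * (k + 1) + 1 = (2 * k + 1) + 1 + 1 by ring, Finset.sum_range_succ _ (2 * k + 1 + 1),
      Finset.sum_range_succ _ (2 * k + 1), Finset.sum_range_succ _ (k + 1)]
    have := h (2 * k + 1)
    rw [show 2 * (k + 1) = 2 * k + 1 + 1 by ring]
    linarith

lemma aux_mono {Ω : Type*} [MeasurableSpace Ω] (P : Measure Ω) [IsProbabilityMeasure P]
    (Y : Ω → ℝ) (hmom : ∀ n : ℕ, Integrable (fun ω => Y ω ^ n) P)
    (h2 : ∫ ω, Y ω ^ 2 ∂P = 1) : Monotone (fun k : ℕ => ∫ ω, Y ω ^ (2 * k) ∂P) := by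
  refine monotone_nat_of_le_succ fun k => ?_
  have key : 0 ≤ ∫ ω, ((Y ω ^ (2 * (k + 1)) - Y ω ^ (2 * k)) - (Y ω ^ 2 - 1)) ∂P := by
    refine integral_nonneg fun ω => ?_
    have e : (Y ω ^ (2 * (k + 1)) - Y ω ^ (2 * k)) - (Y ω ^ 2 - 1)
        = (Y ω ^ 2 - 1) * ((Y ω ^ 2) ^ k - 1) := by
      rw [pow_mul, pow_mul]; ring
    change 0 ≤ (Y ω ^ (2 * (k + 1)) - Y ω ^ (2 * k)) - (Y ω ^ 2 - 1)
    rw [e]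
    rcases le_total 1 (Y ω ^ 2) with h | h
    · exact mul_nonneg (by linarith) (by linarith [one_le_pow₀ h (n := k)])
    · exact mul_nonneg_of_nonpos_of_nonpos (by linarith)
        (by linarith [pow_le_one₀ (sq_nonneg (Y ω)) h (n := k)])
  have i1 : Integrable (fun ω => Y ω ^ (2 * (k + 1)) - Y ω ^ (2 * k)) P := (hmom _).sub (hmom _)
  have i2 : Integrable (fun ω => Y ω ^ 2 - 1) P := (hmom 2).sub (integrable_const 1)
  rw [integral_sub i1 i2,
    integral_sub (hmom _) (hmom _), integral_sub (hmom 2) (integrable_const 1), h2] at key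
  simp at key
  exact key

lemma aux_odd {Ω : Type*} [MeasurableSpace Ω] (P : Measure Ω)
    (Y : Ω → ℝ) (hY : Measurable Y)
    (hsym : Measure.map Y P = Measure.map (fun ω => -Y ω) P) (n : ℕ) (hn : Odd n) :
    ∫ ω, Y ω ^ n ∂P = 0 := by
  have m : Measurable fun y : ℝ => y ^ n := by fun_prop
  have h1 : ∫ y, y ^ n ∂(Measure.map Y P) = ∫ ω, Y ω ^ n ∂P :=
    integral_map hY.aemeasurable m.aestronglyMeasurable
  have h2 : ∫ y, y ^ n ∂(Measure.map (fun ω => -Y ω) P) = ∫ ω, (-Y ω) ^ n ∂P :=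
    integral_map hY.neg.aemeasurable m.aestronglyMeasurable
  rw [← hsym, h1] at h2
  simp only [hn.neg_pow, integral_neg] at h2
  linarith

lemma aux_bound (σ T t : ℝ) (hσ : 0 < σ) (ht : t ∈ Set.Icc 0 T) (M : ℕ → ℝ)
    (hM0 : M 0 = 1) (hM : Monotone fun k => M (2 * k)) (L j : ℕ) (hj : j ≤ L) :
    ∑ i ∈ Finset.range (j + 1),
      ((2 * j).choose (2 * i) : ℝ) * (Real.sqrt t * σ / 2) ^ (2 * j - 2 * i) * M (2 * j - 2 * i)
      ≤ 1 + M (2 * L) * ((1 + σ / 2 * Real.sqrt (max 1 T)) ^ 2) ^ L * t := by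
  obtain ⟨ht0, htT⟩ := ht
  have hML : 0 ≤ M (2 * L) := by
    have := hM (Nat.zero_le L)
    simp [hM0] at this
    linarith
  set u := σ / 2 * Real.sqrt (max 1 T) with hu
  have hu0 : 0 ≤ u := by positivity
  rw [Finset.sum_range_succ]
  have hlast : ((2 * j).choose (2 * j) : ℝ) * (Real.sqrt t * σ / 2) ^ (2 * j - 2 * j)
      * M (2 * j - 2 * j) = 1 := by simp [hM0]
  rw [hlast, add_comm]
  gcongr
  have h1 : ∀ i ∈ Finset.range j,
      ((2 * j).choose (2 * i) : ℝ) * (Real.sqrt t * σ / 2) ^ (2 * j - 2 * i) * M (2 * j - 2 * i)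
      ≤ (M (2 * L) * t) * (((2 * j).choose (2 * i) : ℝ) * u ^ (2 * j - 2 * i)) := by
    intro i hi
    rw [Finset.mem_range] at hi
    obtain ⟨n, rfl⟩ := Nat.exists_eq_add_of_lt hi
    rw [show 2 * (i + n + 1) - 2 * i = 2 * (n + 1) by omega]
    have hm : M (2 * (n + 1)) ≤ M (2 * L) := hM (by omega)
    have hm0 : 0 ≤ M (2 * (n + 1)) := by
      have := hM (Nat.zero_le (n + 1))
      simp only [mul_zero, hM0] at this
      linarith
    have e1 : (Real.sqrt t * σ / 2) ^ (2 * (n + 1)) = (t * t ^ n) * ((σ / 2) ^ 2) ^ (n + 1) := by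
      rw [pow_mul, mul_div_assoc, mul_pow, Real.sq_sqrt ht0, mul_pow]; ring
    have e2 : u ^ (2 * (n + 1)) = (max 1 T) ^ (n + 1) * ((σ / 2) ^ 2) ^ (n + 1) := by
      rw [pow_mul, hu, mul_pow, Real.sq_sqrt (by positivity), mul_pow]; ring
    have h3 : t ^ n ≤ (max 1 T) ^ (n + 1) :=
      (pow_le_pow_left₀ ht0 (htT.trans (le_max_right _ _)) n).trans
        (pow_le_pow_right₀ (le_max_left _ _) (Nat.le_succ n))
    rw [e1, e2]
    calc _ ≤ (((2 * (i + n + 1)).choose (2 * i) : ℕ) : ℝ) *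
          ((t * (max 1 T) ^ (n + 1)) * ((σ / 2) ^ 2) ^ (n + 1)) * M (2 * L) := by
          gcongr
      _ = _ := by ring
  have h2 : ∑ i ∈ Finset.range (j + 1), (((2 * j).choose (2 * i) : ℝ) * u ^ (2 * j - 2 * i))
      ≤ (1 + u) ^ (2 * j) := by
    rw [add_pow]
    refine (aux_le (fun m => ((2 * j).choose m : ℝ) * u ^ (2 * j - m)) (fun i => by positivity)
      j).trans (le_of_eq (Finset.sum_congr rfl fun m _ => ?_))
    simp; ring
  have h3 : ∑ i ∈ Finset.range j, (((2 * j).choose (2 * i) : ℝ) * u ^ (2 * j - 2 * i))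
      ≤ ((1 + u) ^ 2) ^ L := by
    rw [Finset.sum_range_succ] at h2
    have : (1 + u) ^ (2 * j) ≤ (1 + u) ^ (2 * L) :=
      pow_le_pow_right₀ (by linarith) (by omega)
    rw [← pow_mul]
    have : 0 ≤ (((2 * j).choose (2 * j) : ℝ) * u ^ (2 * j - 2 * j)) := by positivity
    linarith
  refine (Finset.sum_le_sum h1).trans ?_
  rw [← Finset.mul_sum]
  calc _ ≤ (M (2 * L) * t) * ((1 + u) ^ 2) ^ L := by gcongr
    _ = _ := by ring

/-- For `σ² ≤ 4a`, the polynomial space is stable by the operator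
`f ↦ E[f(X_1(√t Y, ·))]` with `X_1(w,x) = (√x + wσ/2)²`, and
`‖E[f(X_1(√t Y, ·))]‖ ≤ (1 + E[Y^{2L}] C₁^L t) ‖f‖` with
`C₁ = (1 + (σ/2)√(1∨T))²`, for a symmetric `Y` with `E[Y²] = 1` and all moments
finite. -/
theorem stmt_15 (a σ T : ℝ) (hσ : 0 < σ) (h4a : σ ^ 2 ≤ 4 * a) (hT : 0 < T)
    {Ω : Type*} [MeasurableSpace Ω] (P : Measure Ω) [IsProbabilityMeasure P]
    (Y : Ω → ℝ) (hY : Measurable Y)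
    (hsym : Measure.map Y P = Measure.map (fun ω => -Y ω) P)
    (hmom : ∀ n : ℕ, Integrable (fun ω => Y ω ^ n) P)
    (h2 : ∫ ω, Y ω ^ 2 ∂P = 1)
    (L : ℕ) (co : ℕ → ℝ) (t : ℝ) (ht : t ∈ Set.Icc 0 T) :
    ∃ b : ℕ → ℝ,
      (∀ x : ℝ, 0 ≤ x →
        ∫ ω, ∑ j ∈ Finset.range (L + 1),
            co j * ((Real.sqrt x + Real.sqrt t * Y ω * σ / 2) ^ 2) ^ j ∂P
          = ∑ j ∈ Finset.range (L + 1), b j * x ^ j) ∧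
      ∑ j ∈ Finset.range (L + 1), |b j|
        ≤ (1 + (∫ ω, Y ω ^ (2 * L) ∂P) *
              ((1 + σ / 2 * Real.sqrt (max 1 T)) ^ 2) ^ L * t) *
            ∑ j ∈ Finset.range (L + 1), |co j| := by
  set M : ℕ → ℝ := fun n => ∫ ω, Y ω ^ n ∂P with hMdef
  have hM0 : M 0 = 1 := by simp [hMdef]
  have hMm : Monotone fun k => M (2 * k) := aux_mono P Y hmom h2
  have hMn : ∀ k, 0 ≤ M (2 * k) := fun k => by
    have := hMm (Nat.zero_le k)
    simp [hM0] at this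
    linarith
  have hodd : ∀ n, Odd n → M n = 0 := fun n hn => aux_odd P Y hY hsym n hn
  set r := Real.sqrt t * σ / 2 with hr
  have hr0 : 0 ≤ r := by positivity
  set c : ℕ → ℕ → ℝ := fun j i =>
    ((2 * j).choose (2 * i) : ℝ) * r ^ (2 * j - 2 * i) * M (2 * j - 2 * i) with hc
  have hc0 : ∀ j i, 0 ≤ c j i := fun j i => by
    have := hMn (j - i)
    rw [Nat.mul_sub] at this
    simp only [hc]
    positivity
  have hext : ∀ j ∈ Finset.range (L + 1), ∀ g : ℕ → ℝ,
      ∑ i ∈ Finset.range (L + 1), c j i * g i = ∑ i ∈ Finset.range (j + 1), c j i * g i := by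
    intro j hj g
    symm
    rw [Finset.mem_range] at hj
    refine Finset.sum_subset (Finset.range_subset_range.2 (by omega)) fun i _ hi => ?_
    rw [Finset.mem_range] at hi
    simp [hc, Nat.choose_eq_zero_of_lt (show 2 * j < 2 * i by omega)]
  refine ⟨fun i => ∑ j ∈ Finset.range (L + 1), co j * c j i, fun x hx => ?_, ?_⟩
  · have hexp : ∀ j ω, ((Real.sqrt x + Real.sqrt t * Y ω * σ / 2) ^ 2) ^ j
        = ∑ m ∈ Finset.range (2 * j + 1),
          (Real.sqrt x ^ m * r ^ (2 * j - m) * ((2 * j).choose m : ℝ)) * Y ω ^ (2 * j - m) := by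
      intro j ω
      rw [← pow_mul, show Real.sqrt t * Y ω * σ / 2 = r * Y ω by rw [hr]; ring, add_pow]
      refine Finset.sum_congr rfl fun m _ => ?_
      rw [mul_pow]; ring
    have hint : ∀ j, Integrable
        (fun ω => ((Real.sqrt x + Real.sqrt t * Y ω * σ / 2) ^ 2) ^ j) P := by
      intro j
      simp only [hexp]
      exact integrable_finsetSum _ fun m _ => (hmom _).const_mul _
    have hval : ∀ j, ∫ ω, ((Real.sqrt x + Real.sqrt t * Y ω * σ / 2) ^ 2) ^ j ∂P
        = ∑ i ∈ Finset.range (j + 1), c j i * x ^ i := by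
      intro j
      simp only [hexp]
      rw [integral_finsetSum _ fun m _ => (hmom _).const_mul _]
      simp only [integral_const_mul]
      have hz : ∑ m ∈ Finset.range (2 * j + 1),
          Real.sqrt x ^ m * r ^ (2 * j - m) * ((2 * j).choose m : ℝ) * M (2 * j - m)
          = ∑ i ∈ Finset.range (j + 1), Real.sqrt x ^ (2 * i) * r ^ (2 * j - 2 * i) *
            ((2 * j).choose (2 * i) : ℝ) * M (2 * j - 2 * i) := by
        refine aux_even (fun m => Real.sqrt x ^ m * r ^ (2 * j - m) * ((2 * j).choose m : ℝ)
          * M (2 * j - m)) (fun i => ?_) j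
        rcases lt_or_ge (2 * j) (2 * i + 1) with h | h
        · simp [Nat.choose_eq_zero_of_lt h]
        · have : M (2 * j - (2 * i + 1)) = 0 := hodd _ ⟨j - i - 1, by omega⟩
          simp [this]
      refine hz.trans (Finset.sum_congr rfl fun i _ => ?_)
      rw [pow_mul, Real.sq_sqrt hx]
      simp only [hc]; ring
    rw [integral_finsetSum _ fun j _ => (hint j).const_mul _]
    simp only [integral_const_mul, hval, Finset.sum_mul]
    rw [Finset.sum_comm]
    refine Finset.sum_congr rfl fun j hj => ?_
    rw [← hext j hj, Finset.mul_sum]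
    exact Finset.sum_congr rfl fun i _ => by ring
  · have hb : ∀ j ∈ Finset.range (L + 1), ∑ i ∈ Finset.range (L + 1), c j i
        ≤ 1 + M (2 * L) * ((1 + σ / 2 * Real.sqrt (max 1 T)) ^ 2) ^ L * t := by
      intro j hj
      have := hext j hj (fun _ => 1)
      simp only [mul_one] at this
      rw [this]
      rw [Finset.mem_range] at hj
      exact aux_bound σ T t hσ ht M hM0 hMm L j (by omega)
    calc _ ≤ ∑ i ∈ Finset.range (L + 1), ∑ j ∈ Finset.range (L + 1), |co j| * c j i := by
          refine Finset.sum_le_sum fun i _ => (Finset.abs_sum_le_sum_abs _ _).trans (le_of_eq ?_)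
          exact Finset.sum_congr rfl fun j _ => by rw [abs_mul, abs_of_nonneg (hc0 j i)]
      _ = ∑ j ∈ Finset.range (L + 1), |co j| * ∑ i ∈ Finset.range (L + 1), c j i := by
          rw [Finset.sum_comm]
          simp only [Finset.mul_sum]
      _ ≤ ∑ j ∈ Finset.range (L + 1), |co j| *
          (1 + M (2 * L) * ((1 + σ / 2 * Real.sqrt (max 1 T)) ^ 2) ^ L * t) :=
          Finset.sum_le_sum fun j hj => mul_le_mul_of_nonneg_left (hb j hj) (abs_nonneg _)
      _ = _ := by rw [← Finset.sum_mul, mul_comm]
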